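/- (i) Let ρ and σ be weak coactions of H^0 on unital C*-algebras A and B, respectively. If ρ is strongly Morita equivalent to σ, then ρ is inner if and only if σ is inner. (ii) Let ρ and σ be coactions of H^0 on A and B, respectively. If ρ is strongly Morita equivalent to σ, then ρ is strongly inner if and only if σ is strongly inner. -/

import Mathlib

open scoped TensorProduct
open Filter Topology
set_option maxHeartbeats 1000000
set_option linter.unusedSectionVars false
set_option synthInstance.maxHeartbeats 400000
noncomputable section
namespace SMEPaper
universe u

/-! ### Generalities on tensor products with a finite dimensional C*-algebra -/

/-- Contraction of the right tensor factor against a linear functional: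
`appRight f (m ⊗ c) = f c • m`. -/
def appRight {M C : Type*} [AddCommGroup M] [Module ℂ M] [AddCommGroup C] [Module ℂ C]
    (f : C →ₗ[ℂ] ℂ) : M ⊗[ℂ] C →ₗ[ℂ] M :=
  (TensorProduct.rid ℂ M).toLinearMap ∘ₗ TensorProduct.map LinearMap.id f

/-- The `i`-th coordinate, with respect to the canonical finite basis of `C`, of an
element of `M ⊗[ℂ] C`. -/
def tcoord {M C : Type*} [AddCommGroup M] [Module ℂ M] [AddCommGroup C] [Module ℂ C]
    [FiniteDimensional ℂ C] (i : Fin (Module.finrank ℂ C)) : M ⊗[ℂ] C →ₗ[ℂ] M :=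
  appRight ((Module.finBasis ℂ C).coord i)

/-- The star operation on `M ⊗[ℂ] C` (`C` finite dimensional) where the star operation on the
first factor is supplied as a function: on simple tensors, `m ⊗ c ↦ sM m ⊗ star c`. -/
def tstarWith {M C : Type*} [AddCommGroup M] [Module ℂ M] [Ring C] [Algebra ℂ C]
    [StarRing C] [FiniteDimensional ℂ C] (sM : M → M) (t : M ⊗[ℂ] C) : M ⊗[ℂ] C :=
  ∑ i, sM (tcoord i t) ⊗ₜ star (Module.finBasis ℂ C i)

/-- Combination of an operation on the first factors and an operation on the second (finite
dimensional) factors to an operation on tensor products: on simple tensors,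
`tmix op cop (p ⊗ c) (q ⊗ d) = op p q ⊗ cop c d`. -/
def tmix {P Q R C : Type*} [AddCommGroup P] [Module ℂ P] [AddCommGroup Q] [Module ℂ Q]
    [AddCommGroup R] [Module ℂ R] [Ring C] [Algebra ℂ C] [FiniteDimensional ℂ C]
    (op : P → Q → R) (cop : C → C → C) (s : P ⊗[ℂ] C) (t : Q ⊗[ℂ] C) : R ⊗[ℂ] C :=
  ∑ i, ∑ j,
    op (tcoord i s) (tcoord j t) ⊗ₜ cop (Module.finBasis ℂ C i) (Module.finBasis ℂ C j)

/-- The operation on tensor products induced by an operation on the first factors (and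
multiplication in the second): `tact op (p ⊗ c) (q ⊗ d) = op p q ⊗ (c * d)`. -/
def tact {P Q R C : Type*} [AddCommGroup P] [Module ℂ P] [AddCommGroup Q] [Module ℂ Q]
    [AddCommGroup R] [Module ℂ R] [Ring C] [Algebra ℂ C] [FiniteDimensional ℂ C]
    (op : P → Q → R) : P ⊗[ℂ] C → Q ⊗[ℂ] C → R ⊗[ℂ] C :=
  tmix op (· * ·)

/-- The left inner product on `X ⊗ C` induced by a left (`A`-valued) inner product on `X`:
`(x ⊗ c), (y ⊗ d) ↦ inn x y ⊗ (c * star d)`. -/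
def tinnL {X A C : Type*} [AddCommGroup X] [Module ℂ X] [AddCommGroup A] [Module ℂ A]
    [Ring C] [Algebra ℂ C] [StarRing C] [FiniteDimensional ℂ C]
    (inn : X → X → A) : X ⊗[ℂ] C → X ⊗[ℂ] C → A ⊗[ℂ] C :=
  tmix inn (fun c d => c * star d)

/-- The right inner product on `X ⊗ C` induced by a right (`B`-valued) inner product on `X`:
`(x ⊗ c), (y ⊗ d) ↦ inn x y ⊗ (star c * d)`. -/
def tinnR {X B C : Type*} [AddCommGroup X] [Module ℂ X] [AddCommGroup B] [Module ℂ B]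
    [Ring C] [Algebra ℂ C] [StarRing C] [FiniteDimensional ℂ C]
    (inn : X → X → B) : X ⊗[ℂ] C → X ⊗[ℂ] C → B ⊗[ℂ] C :=
  tmix inn (fun c d => star c * d)

/-! ### Finite dimensional C*-Hopf algebras -/

/-- The data and axioms of a finite dimensional C*-Hopf algebra structure on the finite
dimensional C*-algebra `H0`: a comultiplication, counit and antipode satisfying the Hopf
algebra axioms, compatibly with the ⋆-structure. -/
structure HopfAlgData (H0 : Type u) [Ring H0] [Algebra ℂ H0] [StarRing H0]
    [StarModule ℂ H0] [FiniteDimensional ℂ H0] where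
  comul : H0 →ₐ[ℂ] H0 ⊗[ℂ] H0
  counit : H0 →ₐ[ℂ] ℂ
  antipode : H0 →ₗ[ℂ] H0
  coassoc : ∀ h, TensorProduct.map comul.toLinearMap LinearMap.id (comul h)
      = (TensorProduct.assoc ℂ H0 H0 H0).symm
          (TensorProduct.map LinearMap.id comul.toLinearMap (comul h))
  counit_left : ∀ h,
      (TensorProduct.lid ℂ H0) (TensorProduct.map counit.toLinearMap LinearMap.id (comul h)) = h
  counit_right : ∀ h, appRight counit.toLinearMap (comul h) = h
  antipode_left : ∀ (h : H0) (n : ℕ) (h1 h2 : Fin n → H0),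
      comul h = ∑ i, h1 i ⊗ₜ h2 i → ∑ i, antipode (h1 i) * h2 i = counit h • 1
  antipode_right : ∀ (h : H0) (n : ℕ) (h1 h2 : Fin n → H0),
      comul h = ∑ i, h1 i ⊗ₜ h2 i → ∑ i, h1 i * antipode (h2 i) = counit h • 1
  comul_star : ∀ h, comul (star h) = tstarWith star (comul h)
  counit_star : ∀ h, counit (star h) = starRingEnd ℂ (counit h)

/-! ### Coactions on C*-algebras -/

section Coaction
variable {H0 : Type u} [Ring H0] [Algebra ℂ H0] [StarRing H0] [StarModule ℂ H0]
  [FiniteDimensional ℂ H0]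
variable {A B X : Type u} [Ring A] [Algebra ℂ A] [StarRing A]
  [Ring B] [Algebra ℂ B] [StarRing B] [AddCommGroup X] [Module ℂ X]

/-- `ρ : A → A ⊗ H0` is a weak coaction of `H0` (with counit `ε0`) on `A`:
a unital ⋆-homomorphism with `(id ⊗ ε0) ∘ ρ = id`. -/
structure IsWeakCoaction (ε0 : H0 →ₗ[ℂ] ℂ) (ρ : A →ₗ[ℂ] A ⊗[ℂ] H0) : Prop where
  map_one : ρ 1 = 1
  map_mul : ∀ a b, ρ (a * b) = ρ a * ρ b
  map_star : ∀ a, ρ (star a) = tstarWith star (ρ a)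
  counital : ∀ a, appRight ε0 (ρ a) = a

/-- `ρ : A → A ⊗ H0` is a coaction of `H0` (with comultiplication `Δ0`, counit `ε0`) on `A`:
a weak coaction with `(ρ ⊗ id) ∘ ρ = (id ⊗ Δ0) ∘ ρ`. -/
structure IsCoaction (Δ0 : H0 →ₗ[ℂ] H0 ⊗[ℂ] H0) (ε0 : H0 →ₗ[ℂ] ℂ)
    (ρ : A →ₗ[ℂ] A ⊗[ℂ] H0) extends IsWeakCoaction ε0 ρ : Prop where
  coassoc : ∀ a, TensorProduct.map ρ LinearMap.id (ρ a)
      = (TensorProduct.assoc ℂ A H0 H0).symm (TensorProduct.map LinearMap.id Δ0 (ρ a))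

/-- The pair `(ρ, u)` is a twisted coaction of `H0` on `A`. -/
structure IsTwistedCoaction (Δ0 : H0 →ₗ[ℂ] H0 ⊗[ℂ] H0) (ε0 : H0 →ₗ[ℂ] ℂ)
    (ρ : A →ₗ[ℂ] A ⊗[ℂ] H0) (u : (A ⊗[ℂ] H0) ⊗[ℂ] H0)
    extends IsWeakCoaction ε0 ρ : Prop where
  unitary_left : u * tstarWith (tstarWith star) u = 1
  unitary_right : tstarWith (tstarWith star) u * u = 1
  twisted_coassoc : ∀ a, TensorProduct.map ρ LinearMap.id (ρ a)
      = u * ((TensorProduct.assoc ℂ A H0 H0).symm (TensorProduct.map LinearMap.id Δ0 (ρ a)))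
        * tstarWith (tstarWith star) u
  cocycle : (u ⊗ₜ (1 : H0))
        * TensorProduct.map ((TensorProduct.assoc ℂ A H0 H0).symm.toLinearMap
            ∘ₗ TensorProduct.map LinearMap.id Δ0) LinearMap.id u
      = TensorProduct.map (TensorProduct.map ρ LinearMap.id) LinearMap.id u
        * (TensorProduct.assoc ℂ (A ⊗[ℂ] H0) H0 H0).symm
            (TensorProduct.map LinearMap.id Δ0 u)
  counit_mid : ∀ h : Module.Dual ℂ H0, appRight h (appRight ε0 u) = h 1 • (1 : A)
  counit_out : ∀ h : Module.Dual ℂ H0, appRight ε0 (appRight h u) = h 1 • (1 : A)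

/-- The trivial coaction `a ↦ a ⊗ 1` of `H0` on `A`. -/
def trivialCoaction (H0 : Type u) [Ring H0] [Algebra ℂ H0] (A : Type u) [Ring A]
    [Algebra ℂ A] : A →ₗ[ℂ] A ⊗[ℂ] H0 :=
  (TensorProduct.mk ℂ A H0).flip 1

end Coaction

/-! ### Hilbert bimodules -/

/-- A (pre-)Hilbert `A`–`B` bimodule structure on `X`: a bimodule with a left `A`-valued and a
right `B`-valued inner product, compatible with the module actions, with the appropriate
(conjugate-)linearity, symmetry, positivity and definiteness properties. -/
structure Bimod (A B X : Type u) [Ring A] [Algebra ℂ A] [StarRing A]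
    [Ring B] [Algebra ℂ B] [StarRing B] [AddCommGroup X] [Module ℂ X] where
  ls : A → X → X
  rs : X → B → X
  linn : X → X → A
  rinn : X → X → B
  ls_one : ∀ x, ls 1 x = x
  ls_mul : ∀ a a' x, ls (a * a') x = ls a (ls a' x)
  ls_add : ∀ a a' x, ls (a + a') x = ls a x + ls a' x
  ls_add' : ∀ a x y, ls a (x + y) = ls a x + ls a y
  ls_smul : ∀ (c : ℂ) a x, ls (c • a) x = c • ls a x
  ls_smul' : ∀ (c : ℂ) a x, ls a (c • x) = c • ls a x
  rs_one : ∀ x, rs x 1 = x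
  rs_mul : ∀ x b b', rs x (b * b') = rs (rs x b) b'
  rs_add : ∀ x b b', rs x (b + b') = rs x b + rs x b'
  rs_add' : ∀ x y b, rs (x + y) b = rs x b + rs y b
  rs_smul : ∀ (c : ℂ) x b, rs x (c • b) = c • rs x b
  rs_smul' : ∀ (c : ℂ) x b, rs (c • x) b = c • rs x b
  ls_rs : ∀ a x b, ls a (rs x b) = rs (ls a x) b
  linn_add_left : ∀ x y z, linn (x + y) z = linn x z + linn y z
  linn_add_right : ∀ x y z, linn x (y + z) = linn x y + linn x z
  rinn_add_left : ∀ x y z, rinn (x + y) z = rinn x z + rinn y z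
  rinn_add_right : ∀ x y z, rinn x (y + z) = rinn x y + rinn x z
  linn_smul_left : ∀ (c : ℂ) x y, linn (c • x) y = c • linn x y
  linn_smul_right : ∀ (c : ℂ) x y, linn x (c • y) = starRingEnd ℂ c • linn x y
  rinn_smul_left : ∀ (c : ℂ) x y, rinn (c • x) y = starRingEnd ℂ c • rinn x y
  rinn_smul_right : ∀ (c : ℂ) x y, rinn x (c • y) = c • rinn x y
  linn_star : ∀ x y, star (linn x y) = linn y x
  rinn_star : ∀ x y, star (rinn x y) = rinn y x
  linn_ls : ∀ a x y, linn (ls a x) y = a * linn x y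
  rinn_rs : ∀ x y b, rinn x (rs y b) = rinn x y * b
  linn_rs : ∀ x y b, linn (rs x b) y = linn x (rs y (star b))
  rinn_ls : ∀ a x y, rinn (ls a x) y = rinn x (ls (star a) y)
  linn_pos : ∀ x, ∃ a, linn x x = star a * a
  rinn_pos : ∀ x, ∃ b, rinn x x = star b * b
  rinn_def : ∀ x, rinn x x = 0 → x = 0

section BimodDefs
variable {A B X : Type u} [Ring A] [Algebra ℂ A] [StarRing A]
    [Ring B] [Algebra ℂ B] [StarRing B] [AddCommGroup X] [Module ℂ X]

/-- A Hilbert bimodule is of finite type if it admits a finite right basis and a finite left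
basis in the sense of Kajiwara–Watatani. -/
def Bimod.FiniteType (bm : Bimod A B X) : Prop :=
  (∃ (n : ℕ) (u : Fin n → X), ∀ x, ∑ i, bm.rs (u i) (bm.rinn (u i) x) = x) ∧
  (∃ (m : ℕ) (v : Fin m → X), ∀ x, ∑ j, bm.ls (bm.linn x (v j)) (v j) = x)

/-- An equivalence bimodule: both inner products are full and the associativity condition
`_A⟨x,y⟩ • z = x • ⟨y,z⟩_B` holds. -/
def Bimod.IsEquivalence (bm : Bimod A B X) : Prop :=
  (∀ x y z, bm.ls (bm.linn x y) z = bm.rs x (bm.rinn y z)) ∧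
  Submodule.span ℂ (Set.range fun p : X × X => bm.linn p.1 p.2) = ⊤ ∧
  Submodule.span ℂ (Set.range fun p : X × X => bm.rinn p.1 p.2) = ⊤

end BimodDefs

/-! ### Coactions on Hilbert bimodules, covariant systems, strong Morita equivalence -/

section BimodCoaction
variable {H0 : Type u} [Ring H0] [Algebra ℂ H0] [StarRing H0] [StarModule ℂ H0]
  [FiniteDimensional ℂ H0]
variable {A B X : Type u} [Ring A] [Algebra ℂ A] [StarRing A]
  [Ring B] [Algebra ℂ B] [StarRing B] [AddCommGroup X] [Module ℂ X]

/-- `(A, B, X, ρ, σ, λ, H0)` is a weak covariant system: `lam` is a weak coaction of `H0` on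
the Hilbert `A`–`B` bimodule `X` with respect to `(A, B, ρ, σ)`. -/
structure IsWeakCoactionBimod (ε0 : H0 →ₗ[ℂ] ℂ) (bm : Bimod A B X)
    (ρ : A →ₗ[ℂ] A ⊗[ℂ] H0) (σ : B →ₗ[ℂ] B ⊗[ℂ] H0)
    (lam : X →ₗ[ℂ] X ⊗[ℂ] H0) : Prop where
  ls_compat : ∀ a x, lam (bm.ls a x) = tact bm.ls (ρ a) (lam x)
  rs_compat : ∀ x b, lam (bm.rs x b) = tact bm.rs (lam x) (σ b)
  linn_compat : ∀ x y, ρ (bm.linn x y) = tinnL bm.linn (lam x) (lam y)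
  rinn_compat : ∀ x y, σ (bm.rinn x y) = tinnR bm.rinn (lam x) (lam y)
  counital : ∀ x, appRight ε0 (lam x) = x

/-- `(A, B, X, ρ, σ, λ, H0)` is a covariant system: `lam` is a coaction of `H0` on the
Hilbert `A`–`B` bimodule `X` with respect to `(A, B, ρ, σ)`. -/
structure IsCoactionBimod (Δ0 : H0 →ₗ[ℂ] H0 ⊗[ℂ] H0) (ε0 : H0 →ₗ[ℂ] ℂ) (bm : Bimod A B X)
    (ρ : A →ₗ[ℂ] A ⊗[ℂ] H0) (σ : B →ₗ[ℂ] B ⊗[ℂ] H0) (lam : X →ₗ[ℂ] X ⊗[ℂ] H0)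
    extends IsWeakCoactionBimod ε0 bm ρ σ lam : Prop where
  coassoc : ∀ x, TensorProduct.map lam LinearMap.id (lam x)
      = (TensorProduct.assoc ℂ X H0 H0).symm (TensorProduct.map LinearMap.id Δ0 (lam x))

/-- `(A, B, X, ρ, u, σ, v, λ, H0)` is a twisted covariant system: `lam` is a twisted coaction
of `H0` on the Hilbert `A`–`B` bimodule `X` with respect to `(A, B, ρ, u, σ, v)`. -/
structure IsTwistedCoactionBimod (Δ0 : H0 →ₗ[ℂ] H0 ⊗[ℂ] H0) (ε0 : H0 →ₗ[ℂ] ℂ)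
    (bm : Bimod A B X) (ρ : A →ₗ[ℂ] A ⊗[ℂ] H0) (u : (A ⊗[ℂ] H0) ⊗[ℂ] H0)
    (σ : B →ₗ[ℂ] B ⊗[ℂ] H0) (v : (B ⊗[ℂ] H0) ⊗[ℂ] H0) (lam : X →ₗ[ℂ] X ⊗[ℂ] H0)
    extends IsWeakCoactionBimod ε0 bm ρ σ lam : Prop where
  twisted : ∀ x, TensorProduct.map lam LinearMap.id (lam x)
      = tact (tact bm.rs)
          (tact (tact bm.ls) u
            ((TensorProduct.assoc ℂ X H0 H0).symm (TensorProduct.map LinearMap.id Δ0 (lam x))))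
          (tstarWith (tstarWith star) v)

/-- Two weak coactions `ρ` (on `A`) and `σ` (on `B`) of `H0` are strongly Morita equivalent
if there are an `A`–`B` equivalence bimodule `X` and a weak coaction of `H0` on `X` with
respect to `(A, B, ρ, σ)`. -/
def WeakSME (ε0 : H0 →ₗ[ℂ] ℂ) (ρ : A →ₗ[ℂ] A ⊗[ℂ] H0) (σ : B →ₗ[ℂ] B ⊗[ℂ] H0) : Prop :=
  ∃ (X : Type u) (_ : AddCommGroup X) (_ : Module ℂ X) (bm : Bimod A B X),
    bm.IsEquivalence ∧ ∃ lam : X →ₗ[ℂ] X ⊗[ℂ] H0, IsWeakCoactionBimod ε0 bm ρ σ lam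

/-- Two coactions `ρ` (on `A`) and `σ` (on `B`) of `H0` are strongly Morita equivalent if
there are an `A`–`B` equivalence bimodule `X` and a coaction of `H0` on `X` with respect to
`(A, B, ρ, σ)`. -/
def CoactSME (Δ0 : H0 →ₗ[ℂ] H0 ⊗[ℂ] H0) (ε0 : H0 →ₗ[ℂ] ℂ)
    (ρ : A →ₗ[ℂ] A ⊗[ℂ] H0) (σ : B →ₗ[ℂ] B ⊗[ℂ] H0) : Prop :=
  ∃ (X : Type u) (_ : AddCommGroup X) (_ : Module ℂ X) (bm : Bimod A B X),
    bm.IsEquivalence ∧ ∃ lam : X →ₗ[ℂ] X ⊗[ℂ] H0, IsCoactionBimod Δ0 ε0 bm ρ σ lam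

/-- Two twisted coactions `(ρ, u)` (on `A`) and `(σ, v)` (on `B`) of `H0` are strongly Morita
equivalent if there are an `A`–`B` equivalence bimodule `X` and a twisted coaction of `H0` on
`X` with respect to `(A, B, ρ, u, σ, v)`. -/
def TwistedSME (Δ0 : H0 →ₗ[ℂ] H0 ⊗[ℂ] H0) (ε0 : H0 →ₗ[ℂ] ℂ)
    (ρ : A →ₗ[ℂ] A ⊗[ℂ] H0) (u : (A ⊗[ℂ] H0) ⊗[ℂ] H0)
    (σ : B →ₗ[ℂ] B ⊗[ℂ] H0) (v : (B ⊗[ℂ] H0) ⊗[ℂ] H0) : Prop :=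
  ∃ (X : Type u) (_ : AddCommGroup X) (_ : Module ℂ X) (bm : Bimod A B X),
    bm.IsEquivalence ∧
      ∃ lam : X →ₗ[ℂ] X ⊗[ℂ] H0, IsTwistedCoactionBimod Δ0 ε0 bm ρ u σ v lam

end BimodCoaction
/-! ### Inner and strongly inner coactions -/

section Inner
variable {H0 : Type u} [Ring H0] [Algebra ℂ H0] [StarRing H0] [StarModule ℂ H0]
  [FiniteDimensional ℂ H0]
variable {A : Type u} [Ring A] [Algebra ℂ A] [StarRing A]

/-- The convolution product of two functionals `h, l` on `H0`:
`(hl)(φ) = (h ⊗ l)(Δ0 φ)`. -/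
def dualMul (Δ0 : H0 →ₗ[ℂ] H0 ⊗[ℂ] H0) (h l : Module.Dual ℂ H0) : Module.Dual ℂ H0 :=
  LinearMap.mul' ℂ ℂ ∘ₗ TensorProduct.map h l ∘ₗ Δ0

/-- A weak coaction `ρ` of `H0` on `A` is inner: there is a unitary `w ∈ A ⊗ H0` with
`ρ = Ad(w) ∘ ρ⁰` (where `ρ⁰` is the trivial coaction) and `(id ⊗ ε0)(w) = 1`. -/
def IsInnerCoaction (ε0 : H0 →ₗ[ℂ] ℂ) (ρ : A →ₗ[ℂ] A ⊗[ℂ] H0) : Prop :=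
  ∃ w : A ⊗[ℂ] H0, w * tstarWith star w = 1 ∧ tstarWith star w * w = 1 ∧
    (∀ a, ρ a = w * (a ⊗ₜ (1 : H0)) * tstarWith star w) ∧ appRight ε0 w = 1

/-- A coaction `ρ` of `H0` on `A` is strongly inner: it is implemented as `Ad(w) ∘ ρ⁰` by a
unitary `w ∈ A ⊗ H0` with `(id ⊗ ε0)(w) = 1` such that moreover `ŵ(hl) = ŵ(h)ŵ(l)` for all
`h, l ∈ H = (H0)^*`, where `ŵ(h) = (id ⊗ h)(w)`. -/
def IsStronglyInnerCoaction (Δ0 : H0 →ₗ[ℂ] H0 ⊗[ℂ] H0) (ε0 : H0 →ₗ[ℂ] ℂ)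
    (ρ : A →ₗ[ℂ] A ⊗[ℂ] H0) : Prop :=
  ∃ w : A ⊗[ℂ] H0, w * tstarWith star w = 1 ∧ tstarWith star w * w = 1 ∧
    (∀ a, ρ a = w * (a ⊗ₜ (1 : H0)) * tstarWith star w) ∧ appRight ε0 w = 1 ∧
    ∀ h l : Module.Dual ℂ H0,
      appRight (dualMul Δ0 h l) w = appRight h w * appRight l w

end Inner

/-! ### Semilinear form of the tensor operations -/

section TensorOps
variable {C : Type*} [Ring C] [Algebra ℂ C]
variable {P Q R S T U : Type*} [AddCommGroup P] [Module ℂ P] [AddCommGroup Q] [Module ℂ Q]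
  [AddCommGroup R] [Module ℂ R] [AddCommGroup S] [Module ℂ S] [AddCommGroup T] [Module ℂ T]
  [AddCommGroup U] [Module ℂ U]

@[simp] lemma appRight_tmul (f : C →ₗ[ℂ] ℂ) (p : P) (c : C) :
    appRight f (p ⊗ₜ[ℂ] c) = f c • p := by
  simp [appRight]

lemma sum_tcoord [FiniteDimensional ℂ C] (t : P ⊗[ℂ] C) :
    ∑ i, tcoord i t ⊗ₜ[ℂ] Module.finBasis ℂ C i = t := by
  induction t using TensorProduct.induction_on with
  | zero => simp
  | tmul p c =>
    simp only [tcoord, appRight_tmul, TensorProduct.smul_tmul, ← TensorProduct.tmul_sum]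
    congr 1
    exact (Module.finBasis ℂ C).sum_repr c
  | add s t hs ht => simp only [map_add, TensorProduct.add_tmul, Finset.sum_add_distrib, hs, ht]

/-- An element of `M ⊗ C` is determined by its slices. -/
lemma ext_appRight [FiniteDimensional ℂ C] {s t : P ⊗[ℂ] C}
    (h : ∀ f : Module.Dual ℂ C, appRight f s = appRight f t) : s = t := by
  rw [← sum_tcoord s, ← sum_tcoord t]
  exact Finset.sum_congr rfl fun i _ => by rw [tcoord, h]

lemma tmix_eq_map₂ [FiniteDimensional ℂ C] {τ₁ τ₂ : ℂ →+* ℂ}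
    (f : P →ₛₗ[τ₁] Q →ₛₗ[τ₂] R) (g : C →ₛₗ[τ₁] C →ₛₗ[τ₂] C) (s : P ⊗[ℂ] C) (t : Q ⊗[ℂ] C) :
    tmix (fun p q => f p q) (fun c d => g c d) s t = TensorProduct.map₂ f g s t := by
  conv_rhs => rw [← sum_tcoord s, ← sum_tcoord t]
  simp only [tmix, map_sum, LinearMap.sum_apply, TensorProduct.map₂_apply_tmul,
    TensorProduct.map_tmul]
  exact Finset.sum_comm

lemma tstarWith_star {A C : Type*} [Ring A] [Algebra ℂ A] [StarRing A] [StarModule ℂ A]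
    [Ring C] [Algebra ℂ C] [StarRing C] [StarModule ℂ C] [FiniteDimensional ℂ C]
    (t : A ⊗[ℂ] C) : tstarWith star t = star t := by
  conv_rhs => rw [← sum_tcoord t]
  simp [tstarWith, star_sum]

/-- The bilinear operation on tensor products with `C` induced by a bilinear operation on the
first factors and multiplication in `C`. -/
def mulRight (f : P →ₗ[ℂ] Q →ₗ[ℂ] R) : P ⊗[ℂ] C →ₗ[ℂ] Q ⊗[ℂ] C →ₗ[ℂ] R ⊗[ℂ] C :=
  TensorProduct.map₂ f (LinearMap.mul ℂ C)

@[simp] lemma mulRight_tmul (f : P →ₗ[ℂ] Q →ₗ[ℂ] R) (p : P) (q : Q) (c d : C) :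
    mulRight f (p ⊗ₜ[ℂ] c) (q ⊗ₜ[ℂ] d) = f p q ⊗ₜ[ℂ] (c * d) := by
  simp [mulRight]

lemma tact_eq_mulRight [FiniteDimensional ℂ C] (f : P →ₗ[ℂ] Q →ₗ[ℂ] R)
    (s : P ⊗[ℂ] C) (t : Q ⊗[ℂ] C) : tact (fun p q => f p q) s t = mulRight f s t :=
  tmix_eq_map₂ f (LinearMap.mul ℂ C) s t

lemma mulRight_mul {A : Type*} [Ring A] [Algebra ℂ A] (s t : A ⊗[ℂ] C) :
    mulRight (LinearMap.mul ℂ A) s t = s * t := by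
  induction s using TensorProduct.induction_on with
  | zero => simp
  | add s s' hs hs' => simp only [map_add, LinearMap.add_apply, add_mul, hs, hs']
  | tmul p c =>
  induction t using TensorProduct.induction_on with
  | zero => simp
  | add t t' ht ht' => simp only [map_add, mul_add, ht, ht']
  | tmul q d => simp

lemma mulRight_mul_eq {A : Type*} [Ring A] [Algebra ℂ A] :
    mulRight (LinearMap.mul ℂ A) = LinearMap.mul ℂ (A ⊗[ℂ] C) :=
  LinearMap.ext₂ mulRight_mul

lemma mulRight_assoc {g : S →ₗ[ℂ] R →ₗ[ℂ] T} {f : P →ₗ[ℂ] Q →ₗ[ℂ] R}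
    {h : S →ₗ[ℂ] P →ₗ[ℂ] U} {k : U →ₗ[ℂ] Q →ₗ[ℂ] T}
    (H : ∀ s p q, g s (f p q) = k (h s p) q) (s : S ⊗[ℂ] C) (p : P ⊗[ℂ] C) (q : Q ⊗[ℂ] C) :
    mulRight g s (mulRight f p q) = mulRight k (mulRight h s p) q := by
  induction s using TensorProduct.induction_on with
  | zero => simp
  | add s s' hs hs' => simp only [map_add, LinearMap.add_apply, hs, hs']
  | tmul s c =>
  induction p using TensorProduct.induction_on with
  | zero => simp
  | add p p' hp hp' => simp only [map_add, LinearMap.add_apply, hp, hp']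
  | tmul p d =>
  induction q using TensorProduct.induction_on with
  | zero => simp
  | add q q' hq hq' => simp only [map_add, hq, hq']
  | tmul q e => simp [H, mul_assoc]

lemma mulRight_mul_left {A : Type*} [Ring A] [Algebra ℂ A] {f : A →ₗ[ℂ] P →ₗ[ℂ] P}
    (H : ∀ a a' p, f (a * a') p = f a (f a' p)) (a a' : A ⊗[ℂ] C) (t : P ⊗[ℂ] C) :
    mulRight f (a * a') t = mulRight f a (mulRight f a' t) := by
  rw [← mulRight_mul]
  exact (mulRight_assoc (h := LinearMap.mul ℂ A) (fun a a' p => (H a a' p).symm) a a' t).symm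

lemma mulRight_mul_right {A : Type*} [Ring A] [Algebra ℂ A] {f : P →ₗ[ℂ] A →ₗ[ℂ] P}
    (H : ∀ p a a', f p (a * a') = f (f p a) a') (t : P ⊗[ℂ] C) (a a' : A ⊗[ℂ] C) :
    mulRight f t (a * a') = mulRight f (mulRight f t a) a' := by
  rw [← mulRight_mul]
  exact mulRight_assoc (f := LinearMap.mul ℂ A) H t a a'

lemma mulRight_one_left {A : Type*} [Ring A] [Algebra ℂ A] {f : A →ₗ[ℂ] P →ₗ[ℂ] P}
    (H : ∀ p, f 1 p = p) (t : P ⊗[ℂ] C) : mulRight f 1 t = t := by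
  rw [Algebra.TensorProduct.one_def]
  induction t using TensorProduct.induction_on with
  | zero => simp
  | add s t hs ht => simp only [map_add, hs, ht]
  | tmul p c => simp [H]

lemma mulRight_one_right {A : Type*} [Ring A] [Algebra ℂ A] {f : P →ₗ[ℂ] A →ₗ[ℂ] P}
    (H : ∀ p, f p 1 = p) (t : P ⊗[ℂ] C) : mulRight f t 1 = t := by
  rw [Algebra.TensorProduct.one_def]
  induction t using TensorProduct.induction_on with
  | zero => simp
  | add s t hs ht => simp only [map_add, LinearMap.add_apply, hs, ht]
  | tmul p c => simp [H]

lemma appRight_mulRight (ε : C →ₐ[ℂ] ℂ) (f : P →ₗ[ℂ] Q →ₗ[ℂ] R)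
    (s : P ⊗[ℂ] C) (t : Q ⊗[ℂ] C) :
    appRight ε.toLinearMap (mulRight f s t)
      = f (appRight ε.toLinearMap s) (appRight ε.toLinearMap t) := by
  induction s using TensorProduct.induction_on with
  | zero => simp
  | add s s' hs hs' => simp only [map_add, LinearMap.add_apply, hs, hs']
  | tmul p c =>
  induction t using TensorProduct.induction_on with
  | zero => simp
  | add t t' ht ht' => simp only [map_add, ht, ht']
  | tmul q d => simp [smul_smul, mul_comm]

lemma appRight_mulRight_tmul_one_left (h : Module.Dual ℂ C) (f : P →ₗ[ℂ] Q →ₗ[ℂ] R)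
    (p : P) (t : Q ⊗[ℂ] C) :
    appRight h (mulRight f (p ⊗ₜ[ℂ] (1 : C)) t) = f p (appRight h t) := by
  induction t using TensorProduct.induction_on with
  | zero => simp
  | add t t' ht ht' => simp only [map_add, ht, ht']
  | tmul q d => simp

lemma appRight_mulRight_tmul_one_right (h : Module.Dual ℂ C) (f : P →ₗ[ℂ] Q →ₗ[ℂ] R)
    (q : Q) (t : P ⊗[ℂ] C) :
    appRight h (mulRight f t (q ⊗ₜ[ℂ] (1 : C))) = f (appRight h t) q := by
  induction t using TensorProduct.induction_on with
  | zero => simp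
  | add t t' ht ht' => simp only [map_add, LinearMap.add_apply, ht, ht']
  | tmul q d => simp

/-- Faithfulness of a right action passes to tensor products. -/
lemma mulRight_faithful_right [FiniteDimensional ℂ C] {f : P →ₗ[ℂ] Q →ₗ[ℂ] R} {ι : T → P}
    (H : ∀ q q', (∀ t, f (ι t) q = f (ι t) q') → q = q') (q q' : Q ⊗[ℂ] C)
    (h : ∀ t, mulRight f (ι t ⊗ₜ[ℂ] (1 : C)) q = mulRight f (ι t ⊗ₜ[ℂ] (1 : C)) q') :
    q = q' :=
  ext_appRight fun l => H _ _ fun t => by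
    rw [← appRight_mulRight_tmul_one_left, h, appRight_mulRight_tmul_one_left]

/-- Faithfulness of a left action passes to tensor products. -/
lemma mulRight_faithful_left [FiniteDimensional ℂ C] {f : P →ₗ[ℂ] Q →ₗ[ℂ] R} {ι : T → Q}
    (H : ∀ p p', (∀ t, f p (ι t) = f p' (ι t)) → p = p') (p p' : P ⊗[ℂ] C)
    (h : ∀ t, mulRight f p (ι t ⊗ₜ[ℂ] (1 : C)) = mulRight f p' (ι t ⊗ₜ[ℂ] (1 : C))) :
    p = p' :=
  ext_appRight fun l => H _ _ fun t => by
    rw [← appRight_mulRight_tmul_one_right, h, appRight_mulRight_tmul_one_right]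

/-! ### Comultiplication on the second leg and insertion of a middle leg -/

/-- `id ⊗ Δ : M ⊗ C → (M ⊗ C) ⊗ C`. -/
def comulLeg (Δ : C →ₗ[ℂ] C ⊗[ℂ] C) (P : Type*) [AddCommGroup P] [Module ℂ P] :
    P ⊗[ℂ] C →ₗ[ℂ] (P ⊗[ℂ] C) ⊗[ℂ] C :=
  (TensorProduct.assoc ℂ P C C).symm.toLinearMap ∘ₗ TensorProduct.map LinearMap.id Δ

/-- The leg embedding `m ⊗ c ↦ (m ⊗ 1) ⊗ c`. -/
def insertLeg (C : Type*) [Ring C] [Algebra ℂ C] (P : Type*) [AddCommGroup P] [Module ℂ P] :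
    P ⊗[ℂ] C →ₗ[ℂ] (P ⊗[ℂ] C) ⊗[ℂ] C :=
  TensorProduct.map ((TensorProduct.mk ℂ P C).flip 1) LinearMap.id

@[simp] lemma insertLeg_tmul (p : P) (c : C) :
    insertLeg C P (p ⊗ₜ c) = (p ⊗ₜ 1) ⊗ₜ c := by
  simp [insertLeg]

lemma comulLeg_tmul_one (Δ : C →ₐ[ℂ] C ⊗[ℂ] C) (p : P) :
    comulLeg Δ.toLinearMap P (p ⊗ₜ 1) = (p ⊗ₜ 1) ⊗ₜ 1 := by
  simp [comulLeg, Algebra.TensorProduct.one_def]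

lemma insertLeg_mulRight (f : P →ₗ[ℂ] Q →ₗ[ℂ] R) (s : P ⊗[ℂ] C) (t : Q ⊗[ℂ] C) :
    insertLeg C R (mulRight f s t)
      = mulRight (mulRight f) (insertLeg C P s) (insertLeg C Q t) := by
  induction s using TensorProduct.induction_on with
  | zero => simp
  | add s s' hs hs' => simp only [map_add, LinearMap.add_apply, hs, hs']
  | tmul p c =>
  induction t using TensorProduct.induction_on with
  | zero => simp
  | add t t' ht ht' => simp only [map_add, ht, ht']
  | tmul q d => simp

lemma assoc_symm_mulRight (f : P →ₗ[ℂ] Q →ₗ[ℂ] R) (p : P) (q : Q) (c d : C ⊗[ℂ] C) :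
    (TensorProduct.assoc ℂ R C C).symm (f p q ⊗ₜ (c * d))
      = mulRight (mulRight f) ((TensorProduct.assoc ℂ P C C).symm (p ⊗ₜ c))
          ((TensorProduct.assoc ℂ Q C C).symm (q ⊗ₜ d)) := by
  induction c using TensorProduct.induction_on with
  | zero => simp
  | add s s' hs hs' =>
    simp only [add_mul, TensorProduct.tmul_add, map_add, LinearMap.add_apply, hs, hs']
  | tmul c c' =>
  induction d using TensorProduct.induction_on with
  | zero => simp
  | add t t' ht ht' => simp only [mul_add, TensorProduct.tmul_add, map_add, ht, ht']
  | tmul d d' => simp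

lemma comulLeg_mulRight (Δ : C →ₐ[ℂ] C ⊗[ℂ] C) (f : P →ₗ[ℂ] Q →ₗ[ℂ] R)
    (s : P ⊗[ℂ] C) (t : Q ⊗[ℂ] C) :
    comulLeg Δ.toLinearMap R (mulRight f s t)
      = mulRight (mulRight f) (comulLeg Δ.toLinearMap P s) (comulLeg Δ.toLinearMap Q t) := by
  induction s using TensorProduct.induction_on with
  | zero => simp
  | add s s' hs hs' => simp only [map_add, LinearMap.add_apply, hs, hs']
  | tmul p c =>
  induction t using TensorProduct.induction_on with
  | zero => simp
  | add t t' ht ht' => simp only [map_add, ht, ht']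
  | tmul q d => simp [comulLeg, assoc_symm_mulRight]

lemma comulLeg_mul {A : Type*} [Ring A] [Algebra ℂ A] (Δ : C →ₐ[ℂ] C ⊗[ℂ] C)
    (s t : A ⊗[ℂ] C) :
    comulLeg Δ.toLinearMap A (s * t)
      = comulLeg Δ.toLinearMap A s * comulLeg Δ.toLinearMap A t := by
  simpa [mulRight_mul_eq] using comulLeg_mulRight Δ (LinearMap.mul ℂ A) s t

lemma comulLeg_one {A : Type*} [Ring A] [Algebra ℂ A] (Δ : C →ₐ[ℂ] C ⊗[ℂ] C) :
    comulLeg Δ.toLinearMap A 1 = 1 :=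
  comulLeg_tmul_one Δ (1 : A)

lemma insertLeg_mul {A : Type*} [Ring A] [Algebra ℂ A] (s t : A ⊗[ℂ] C) :
    insertLeg C A (s * t) = insertLeg C A s * insertLeg C A t := by
  simpa [mulRight_mul_eq] using insertLeg_mulRight (LinearMap.mul ℂ A) s t

lemma insertLeg_one {A : Type*} [Ring A] [Algebra ℂ A] :
    insertLeg C A (1 : A ⊗[ℂ] C) = 1 :=
  insertLeg_tmul (1 : A) (1 : C)

/-- Multiplicativity of the slice map, expressed on the third tensor power. -/
lemma appRight_dualMul_iff {A : Type*} [Ring A] [Algebra ℂ A] [StarRing C] [StarModule ℂ C]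
    [FiniteDimensional ℂ C] (Δ : C →ₗ[ℂ] C ⊗[ℂ] C) (w : A ⊗[ℂ] C) :
    (∀ h l : Module.Dual ℂ C, appRight (dualMul Δ h l) w = appRight h w * appRight l w) ↔
      comulLeg Δ A w = (w ⊗ₜ 1) * insertLeg C A w := by
  have e1 : ∀ h l : Module.Dual ℂ C,
      appRight h (appRight l (comulLeg Δ A w)) = appRight (dualMul Δ h l) w := by
    intro h l
    induction w using TensorProduct.induction_on with
    | zero => simp
    | add s t hs ht => simp only [map_add, hs, ht]
    | tmul a c =>
      simp only [comulLeg, LinearMap.comp_apply, TensorProduct.map_tmul, LinearMap.id_apply,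
        appRight_tmul, dualMul]
      generalize Δ c = d
      induction d using TensorProduct.induction_on with
      | zero => simp
      | add s t hs ht => simp only [TensorProduct.tmul_add, map_add, hs, ht, add_smul]
      | tmul d e => simp [smul_smul, mul_comm]
  have e2 : ∀ h l : Module.Dual ℂ C,
      appRight h (appRight l ((w ⊗ₜ 1) * insertLeg C A w)) = appRight h w * appRight l w := by
    intro h l
    rw [← mulRight_mul, appRight_mulRight_tmul_one_left]
    have : appRight l (insertLeg C A w) = appRight l w ⊗ₜ 1 := by
      clear e1
      induction w using TensorProduct.induction_on with
      | zero => simp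
      | add s t hs ht => simp only [map_add, hs, ht, TensorProduct.add_tmul]
      | tmul a c => simp [TensorProduct.smul_tmul']
    rw [this]
    simpa [mulRight_mul_eq] using
      appRight_mulRight_tmul_one_right h (LinearMap.mul ℂ A) (appRight l w) w
  refine ⟨fun H => ext_appRight fun l => ext_appRight fun h => ?_, fun H h l => ?_⟩
  · rw [e1, e2, H]
  · rw [← e1, ← e2, H]

/-- The two forms of the corepresentation identity for mutually inverse elements. -/
lemma comulLeg_inv_iff {A : Type*} [Ring A] [Algebra ℂ A] (Δ : C →ₐ[ℂ] C ⊗[ℂ] C)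
    {v z : A ⊗[ℂ] C} (hvz : v * z = 1) (hzv : z * v = 1) :
    comulLeg Δ.toLinearMap A v = (v ⊗ₜ 1) * insertLeg C A v ↔
      comulLeg Δ.toLinearMap A z = insertLeg C A z * (z ⊗ₜ 1) := by
  have c1 : comulLeg Δ.toLinearMap A v * comulLeg Δ.toLinearMap A z = 1 := by
    rw [← comulLeg_mul, hvz, comulLeg_one]
  have i1 : insertLeg C A v * insertLeg C A z = 1 := by
    rw [← insertLeg_mul, hvz, insertLeg_one]
  have i2 : insertLeg C A z * insertLeg C A v = 1 := by
    rw [← insertLeg_mul, hzv, insertLeg_one]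
  have t1 : ((v ⊗ₜ[ℂ] (1 : C)) * (z ⊗ₜ[ℂ] (1 : C)) : (A ⊗[ℂ] C) ⊗[ℂ] C) = 1 := by
    rw [Algebra.TensorProduct.tmul_mul_tmul, hvz, mul_one, ← Algebra.TensorProduct.one_def]
  have t2 : ((z ⊗ₜ[ℂ] (1 : C)) * (v ⊗ₜ[ℂ] (1 : C)) : (A ⊗[ℂ] C) ⊗[ℂ] C) = 1 := by
    rw [Algebra.TensorProduct.tmul_mul_tmul, hzv, mul_one, ← Algebra.TensorProduct.one_def]
  have p1 : insertLeg C A z * (z ⊗ₜ 1) * ((v ⊗ₜ 1) * insertLeg C A v) = 1 := by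
    rw [mul_assoc, ← mul_assoc (z ⊗ₜ[ℂ] (1 : C)), t2, one_mul, i2]
  have p2 : ((v ⊗ₜ 1) * insertLeg C A v) * (insertLeg C A z * (z ⊗ₜ 1)) = 1 := by
    rw [mul_assoc, ← mul_assoc (insertLeg C A v), i1, one_mul, t1]
  constructor
  · intro h
    rw [h] at c1
    exact (left_inv_eq_right_inv p1 c1).symm
  · intro h
    rw [h] at c1
    exact left_inv_eq_right_inv c1 p1

end TensorOps

/-! ### Bimodules tensored with the coefficient algebra -/

namespace Bimod
variable {C : Type u} [Ring C] [Algebra ℂ C] [StarRing C] [StarModule ℂ C]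
  [FiniteDimensional ℂ C]
variable {A B X : Type u} [Ring A] [Algebra ℂ A] [StarRing A] [StarModule ℂ A]
  [Ring B] [Algebra ℂ B] [StarRing B] [StarModule ℂ B] [AddCommGroup X] [Module ℂ X]

/-- The left action as a bilinear map. -/
def lsₗ (bm : Bimod A B X) : A →ₗ[ℂ] X →ₗ[ℂ] X :=
  LinearMap.mk₂ ℂ bm.ls bm.ls_add bm.ls_smul bm.ls_add' bm.ls_smul'

/-- The right action as a bilinear map. -/
def rsₗ (bm : Bimod A B X) : X →ₗ[ℂ] B →ₗ[ℂ] X :=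
  LinearMap.mk₂ ℂ bm.rs bm.rs_add' bm.rs_smul' bm.rs_add bm.rs_smul

/-- The left inner product as a sesquilinear map. -/
def linnₗ (bm : Bimod A B X) : X →ₗ[ℂ] X →ₗ⋆[ℂ] A :=
  LinearMap.mk₂'ₛₗ (RingHom.id ℂ) (starRingEnd ℂ) bm.linn bm.linn_add_left bm.linn_smul_left
    bm.linn_add_right (fun c x y => bm.linn_smul_right c x y)

/-- The right inner product as a sesquilinear map. -/
def rinnₗ (bm : Bimod A B X) : X →ₗ⋆[ℂ] X →ₗ[ℂ] B :=
  LinearMap.mk₂'ₛₗ (starRingEnd ℂ) (RingHom.id ℂ) bm.rinn bm.rinn_add_left bm.rinn_smul_left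
    bm.rinn_add_right bm.rinn_smul_right

@[simp] lemma lsₗ_apply (bm : Bimod A B X) (a : A) (x : X) : bm.lsₗ a x = bm.ls a x := rfl
@[simp] lemma rsₗ_apply (bm : Bimod A B X) (x : X) (b : B) : bm.rsₗ x b = bm.rs x b := rfl
@[simp] lemma linnₗ_apply (bm : Bimod A B X) (x y : X) : bm.linnₗ x y = bm.linn x y := rfl
@[simp] lemma rinnₗ_apply (bm : Bimod A B X) (x y : X) : bm.rinnₗ x y = bm.rinn x y := rfl

/-- The map `(c, d) ↦ c * star d` as a sesquilinear map. -/
def mulStar (C : Type u) [Ring C] [Algebra ℂ C] [StarRing C] [StarModule ℂ C] :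
    C →ₗ[ℂ] C →ₗ⋆[ℂ] C :=
  LinearMap.mk₂'ₛₗ (RingHom.id ℂ) (starRingEnd ℂ) (fun c d => c * star d)
    (fun _ _ _ => add_mul _ _ _) (fun _ _ _ => smul_mul_assoc _ _ _)
    (fun _ _ _ => by simp [mul_add]) (fun _ _ _ => by simp [star_smul])

/-- The map `(c, d) ↦ star c * d` as a sesquilinear map. -/
def starMul (C : Type u) [Ring C] [Algebra ℂ C] [StarRing C] [StarModule ℂ C] :
    C →ₗ⋆[ℂ] C →ₗ[ℂ] C :=
  LinearMap.mk₂'ₛₗ (starRingEnd ℂ) (RingHom.id ℂ) (fun c d => star c * d)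
    (fun _ _ _ => by simp [add_mul]) (fun _ _ _ => by simp [star_smul])
    (fun _ _ _ => mul_add _ _ _) (fun _ _ _ => mul_smul_comm _ _ _)

@[simp] lemma mulStar_apply (c d : C) : mulStar C c d = c * star d := rfl
@[simp] lemma starMul_apply (c d : C) : starMul C c d = star c * d := rfl

/-- The `A ⊗ C`-valued inner product on `X ⊗ C` as a sesquilinear map. -/
def tlinn (bm : Bimod A B X) : X ⊗[ℂ] C →ₗ[ℂ] X ⊗[ℂ] C →ₗ⋆[ℂ] A ⊗[ℂ] C :=
  TensorProduct.map₂ bm.linnₗ (mulStar C)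

/-- The `B ⊗ C`-valued inner product on `X ⊗ C` as a sesquilinear map. -/
def trinn (bm : Bimod A B X) : X ⊗[ℂ] C →ₗ⋆[ℂ] X ⊗[ℂ] C →ₗ[ℂ] B ⊗[ℂ] C :=
  TensorProduct.map₂ bm.rinnₗ (starMul C)

variable (bm : Bimod A B X)

lemma tinnL_eq (s t : X ⊗[ℂ] C) : tinnL bm.linn s t = bm.tlinn s t := by
  rw [tlinn, ← tmix_eq_map₂]
  rfl

lemma tinnR_eq (s t : X ⊗[ℂ] C) : tinnR bm.rinn s t = bm.trinn s t := by
  rw [trinn, ← tmix_eq_map₂]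
  rfl

@[simp] lemma tlinn_tmul (x y : X) (c d : C) :
    bm.tlinn (x ⊗ₜ c) (y ⊗ₜ d) = bm.linn x y ⊗ₜ (c * star d) := by
  simp [tlinn]

@[simp] lemma trinn_tmul (x y : X) (c d : C) :
    bm.trinn (x ⊗ₜ c) (y ⊗ₜ d) = bm.rinn x y ⊗ₜ (star c * d) := by
  simp [trinn]

lemma tlinn_star (s t : X ⊗[ℂ] C) : star (bm.tlinn s t) = bm.tlinn t s := by
  induction s using TensorProduct.induction_on with
  | zero => simp
  | add s s' hs hs' => simp only [map_add, LinearMap.add_apply, star_add, hs, hs']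
  | tmul x c =>
  induction t using TensorProduct.induction_on with
  | zero => simp
  | add s s' hs hs' => simp only [map_add, LinearMap.add_apply, star_add, hs, hs']
  | tmul y d => simp [bm.linn_star]

lemma trinn_star (s t : X ⊗[ℂ] C) : star (bm.trinn s t) = bm.trinn t s := by
  induction s using TensorProduct.induction_on with
  | zero => simp
  | add s s' hs hs' => simp only [map_add, LinearMap.add_apply, star_add, hs, hs']
  | tmul x c =>
  induction t using TensorProduct.induction_on with
  | zero => simp
  | add s s' hs hs' => simp only [map_add, LinearMap.add_apply, star_add, hs, hs']
  | tmul y d => simp [bm.rinn_star]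

lemma tlinn_ls (a : A ⊗[ℂ] C) (s t : X ⊗[ℂ] C) :
    bm.tlinn (mulRight bm.lsₗ a s) t = a * bm.tlinn s t := by
  induction a using TensorProduct.induction_on with
  | zero => simp
  | add s s' hs hs' => simp only [map_add, LinearMap.add_apply, add_mul, hs, hs']
  | tmul a c =>
  induction s using TensorProduct.induction_on with
  | zero => simp
  | add s s' hs hs' => simp only [map_add, LinearMap.add_apply, mul_add, hs, hs']
  | tmul x d =>
  induction t using TensorProduct.induction_on with
  | zero => simp
  | add s s' hs hs' => simp only [map_add, mul_add, hs, hs']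
  | tmul y e => simp [bm.linn_ls, mul_assoc]

lemma trinn_rs (s t : X ⊗[ℂ] C) (b : B ⊗[ℂ] C) :
    bm.trinn s (mulRight bm.rsₗ t b) = bm.trinn s t * b := by
  induction b using TensorProduct.induction_on with
  | zero => simp
  | add s s' hs hs' => simp only [map_add, mul_add, hs, hs']
  | tmul a c =>
  induction s using TensorProduct.induction_on with
  | zero => simp
  | add s s' hs hs' => simp only [map_add, LinearMap.add_apply, add_mul, hs, hs']
  | tmul x d =>
  induction t using TensorProduct.induction_on with
  | zero => simp
  | add s s' hs hs' => simp only [map_add, LinearMap.add_apply, add_mul, hs, hs']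
  | tmul y e => simp [bm.rinn_rs, mul_assoc]

lemma tlinn_rs (s t : X ⊗[ℂ] C) (b : B ⊗[ℂ] C) :
    bm.tlinn (mulRight bm.rsₗ s b) t = bm.tlinn s (mulRight bm.rsₗ t (star b)) := by
  induction b using TensorProduct.induction_on with
  | zero => simp
  | add s s' hs hs' => simp only [map_add, LinearMap.add_apply, star_add, hs, hs']
  | tmul a c =>
  induction s using TensorProduct.induction_on with
  | zero => simp
  | add s s' hs hs' => simp only [map_add, LinearMap.add_apply, hs, hs']
  | tmul x d =>
  induction t using TensorProduct.induction_on with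
  | zero => simp
  | add s s' hs hs' => simp only [map_add, LinearMap.add_apply, hs, hs']
  | tmul y e => simp [bm.linn_rs, mul_assoc]

lemma trinn_ls (a : A ⊗[ℂ] C) (s t : X ⊗[ℂ] C) :
    bm.trinn (mulRight bm.lsₗ a s) t = bm.trinn s (mulRight bm.lsₗ (star a) t) := by
  induction a using TensorProduct.induction_on with
  | zero => simp
  | add s s' hs hs' => simp only [map_add, LinearMap.add_apply, star_add, hs, hs']
  | tmul a c =>
  induction s using TensorProduct.induction_on with
  | zero => simp
  | add s s' hs hs' => simp only [map_add, LinearMap.add_apply, hs, hs']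
  | tmul x d =>
  induction t using TensorProduct.induction_on with
  | zero => simp
  | add s s' hs hs' => simp only [map_add, hs, hs']
  | tmul y e => simp [bm.rinn_ls, mul_assoc]

lemma tlinn_ls_right (a : A ⊗[ℂ] C) (s t : X ⊗[ℂ] C) :
    bm.tlinn s (mulRight bm.lsₗ a t) = bm.tlinn s t * star a := by
  rw [← tlinn_star, tlinn_ls, star_mul, tlinn_star]

lemma trinn_rs_left (s t : X ⊗[ℂ] C) (b : B ⊗[ℂ] C) :
    bm.trinn (mulRight bm.rsₗ s b) t = star b * bm.trinn s t := by
  rw [← trinn_star, trinn_rs, star_mul, trinn_star]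

lemma tls_mul (a a' : A ⊗[ℂ] C) (t : X ⊗[ℂ] C) :
    mulRight bm.lsₗ (a * a') t = mulRight bm.lsₗ a (mulRight bm.lsₗ a' t) :=
  mulRight_mul_left bm.ls_mul a a' t

lemma trs_mul (t : X ⊗[ℂ] C) (b b' : B ⊗[ℂ] C) :
    mulRight bm.rsₗ t (b * b') = mulRight bm.rsₗ (mulRight bm.rsₗ t b) b' :=
  mulRight_mul_right bm.rs_mul t b b'

lemma tls_trs (a : A ⊗[ℂ] C) (t : X ⊗[ℂ] C) (b : B ⊗[ℂ] C) :
    mulRight bm.lsₗ a (mulRight bm.rsₗ t b) = mulRight bm.rsₗ (mulRight bm.lsₗ a t) b :=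
  mulRight_assoc (fun a x b => bm.ls_rs a x b) a t b

lemma tls_one (t : X ⊗[ℂ] C) : mulRight bm.lsₗ 1 t = t := mulRight_one_left bm.ls_one t

lemma trs_one (t : X ⊗[ℂ] C) : mulRight bm.rsₗ t 1 = t := mulRight_one_right bm.rs_one t

variable {bm}

lemma IsEquivalence.tls_tlinn (he : bm.IsEquivalence) (s t r : X ⊗[ℂ] C) :
    mulRight bm.lsₗ (bm.tlinn s t) r = mulRight bm.rsₗ s (bm.trinn t r) := by
  induction s using TensorProduct.induction_on with
  | zero => simp
  | add s s' hs hs' => simp only [map_add, LinearMap.add_apply, hs, hs']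
  | tmul x c =>
  induction t using TensorProduct.induction_on with
  | zero => simp
  | add s s' hs hs' => simp only [map_add, LinearMap.add_apply, hs, hs']
  | tmul y d =>
  induction r using TensorProduct.induction_on with
  | zero => simp
  | add s s' hs hs' => simp only [map_add, hs, hs']
  | tmul z e => simp [he.1, mul_assoc]

lemma IsEquivalence.linn_induction (he : bm.IsEquivalence) {p : A → Prop}
    (hinn : ∀ x y, p (bm.linn x y)) (hzero : p 0) (hadd : ∀ a a', p a → p a' → p (a + a'))
    (hsmul : ∀ (c : ℂ) a, p a → p (c • a)) (a : A) : p a := by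
  have : a ∈ Submodule.span ℂ (Set.range fun q : X × X => bm.linn q.1 q.2) := by
    rw [he.2.1]; trivial
  refine Submodule.span_induction ?_ hzero (fun a a' _ _ => hadd a a')
    (fun c a _ => hsmul c a) this
  rintro _ ⟨q, rfl⟩
  exact hinn q.1 q.2

lemma IsEquivalence.rinn_induction (he : bm.IsEquivalence) {p : B → Prop}
    (hinn : ∀ x y, p (bm.rinn x y)) (hzero : p 0) (hadd : ∀ a a', p a → p a' → p (a + a'))
    (hsmul : ∀ (c : ℂ) a, p a → p (c • a)) (b : B) : p b := by
  have : b ∈ Submodule.span ℂ (Set.range fun q : X × X => bm.rinn q.1 q.2) := by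
    rw [he.2.2]; trivial
  refine Submodule.span_induction ?_ hzero (fun a a' _ _ => hadd a a')
    (fun c a _ => hsmul c a) this
  rintro _ ⟨q, rfl⟩
  exact hinn q.1 q.2

lemma IsEquivalence.rs_faithful (he : bm.IsEquivalence) (b b' : B)
    (h : ∀ x, bm.rsₗ x b = bm.rsₗ x b') : b = b' := by
  rw [← one_mul b, ← one_mul b']
  refine he.rinn_induction (p := fun d => d * b = d * b') (fun x y => ?_) (by simp)
    (fun _ _ h h' => by rw [add_mul, add_mul, h, h']) (fun c _ h => by simp [h]) 1
  rw [← bm.rinn_rs, ← bm.rinn_rs]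
  exact congrArg _ (h y)

lemma IsEquivalence.ls_faithful (he : bm.IsEquivalence) (a a' : A)
    (h : ∀ x, bm.lsₗ a x = bm.lsₗ a' x) : a = a' := by
  rw [← mul_one a, ← mul_one a']
  refine he.linn_induction (p := fun d => a * d = a' * d) (fun x y => ?_) (by simp)
    (fun _ _ h h' => by rw [mul_add, mul_add, h, h']) (fun c _ h => by simp [h]) 1
  rw [← bm.linn_ls, ← bm.linn_ls]
  exact congrArg (fun z => bm.linn z y) (h x)

/-- A left `A`-linear map `X → X ⊗ C` is given by right multiplication by an element of
`B ⊗ C`. -/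
lemma IsEquivalence.exists_eq_trs (he : bm.IsEquivalence) (μ : X →ₗ[ℂ] X ⊗[ℂ] C)
    (hμ : ∀ a x, μ (bm.ls a x) = mulRight bm.lsₗ (a ⊗ₜ 1) (μ x)) :
    ∃ z : B ⊗[ℂ] C, ∀ x, μ x = mulRight bm.rsₗ (x ⊗ₜ 1) z := by
  suffices H : ∀ b : B, ∃ z : B ⊗[ℂ] C, ∀ x, μ (bm.rs x b) = mulRight bm.rsₗ (x ⊗ₜ 1) z by
    obtain ⟨z, hz⟩ := H 1
    exact ⟨z, fun x => by rw [← hz, bm.rs_one]⟩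
  refine he.rinn_induction (fun u y => ⟨bm.trinn (u ⊗ₜ 1) (μ y), fun x => ?_⟩)
    ⟨0, fun x => ?_⟩ ?_ ?_
  · rw [← he.1, hμ, ← he.tls_tlinn]
    simp
  · rw [← rsₗ_apply, map_zero, map_zero, map_zero]
  · rintro b b' ⟨z, hz⟩ ⟨z', hz'⟩
    exact ⟨z + z', fun x => by rw [bm.rs_add, map_add, hz, hz', map_add]⟩
  · rintro c b ⟨z, hz⟩
    exact ⟨c • z, fun x => by rw [bm.rs_smul, map_smul, hz, map_smul]⟩

/-- A right `B`-linear map `X → X ⊗ C` is given by left multiplication by an element of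
`A ⊗ C`. -/
lemma IsEquivalence.exists_eq_tls (he : bm.IsEquivalence) (μ : X →ₗ[ℂ] X ⊗[ℂ] C)
    (hμ : ∀ x b, μ (bm.rs x b) = mulRight bm.rsₗ (μ x) (b ⊗ₜ 1)) :
    ∃ z : A ⊗[ℂ] C, ∀ x, μ x = mulRight bm.lsₗ z (x ⊗ₜ 1) := by
  suffices H : ∀ a : A, ∃ z : A ⊗[ℂ] C, ∀ x, μ (bm.ls a x) = mulRight bm.lsₗ z (x ⊗ₜ 1) by
    obtain ⟨z, hz⟩ := H 1
    exact ⟨z, fun x => by rw [← hz, bm.ls_one]⟩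
  refine he.linn_induction (fun u y => ⟨bm.tlinn (μ u) (y ⊗ₜ 1), fun x => ?_⟩)
    ⟨0, fun x => ?_⟩ ?_ ?_
  · rw [he.1, hμ, he.tls_tlinn]
    simp
  · rw [← lsₗ_apply, map_zero, map_zero, LinearMap.zero_apply, LinearMap.zero_apply, map_zero]
  · rintro b b' ⟨z, hz⟩ ⟨z', hz'⟩
    exact ⟨z + z', fun x => by rw [bm.ls_add, map_add, hz, hz', map_add, LinearMap.add_apply]⟩
  · rintro c b ⟨z, hz⟩
    exact ⟨c • z, fun x => by rw [bm.ls_smul, map_smul, hz, map_smul, LinearMap.smul_apply]⟩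

end Bimod

/-! ### Implementing unitaries on the two sides of an equivalence bimodule -/

section Implementation
variable {C : Type u} [Ring C] [Algebra ℂ C] [StarRing C] [StarModule ℂ C]
  [FiniteDimensional ℂ C]
variable {A B X : Type u} [Ring A] [Algebra ℂ A] [StarRing A] [StarModule ℂ A]
  [Ring B] [Algebra ℂ B] [StarRing B] [StarModule ℂ B] [AddCommGroup X] [Module ℂ X]
variable {bm : Bimod A B X} {ρ : A →ₗ[ℂ] A ⊗[ℂ] C} {σ : B →ₗ[ℂ] B ⊗[ℂ] C}
  {lam : X →ₗ[ℂ] X ⊗[ℂ] C} {w : A ⊗[ℂ] C} {z : B ⊗[ℂ] C}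

/-- The map `lam` is `x ↦ w (x ⊗ 1) z`. -/
def Implements (bm : Bimod A B X) (lam : X →ₗ[ℂ] X ⊗[ℂ] C) (w : A ⊗[ℂ] C) (z : B ⊗[ℂ] C) :
    Prop :=
  ∀ x, lam x = mulRight bm.rsₗ (mulRight bm.lsₗ w (x ⊗ₜ 1)) z

/-- Left implementation of a weak coaction by a unitary, in terms of the native star. -/
structure IsImplementedBy (ρ : A →ₗ[ℂ] A ⊗[ℂ] C) (w : A ⊗[ℂ] C) : Prop where
  mul_star : w * star w = 1
  star_mul : star w * w = 1
  eq : ∀ a, ρ a = w * (a ⊗ₜ 1) * star w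

lemma isInnerCoaction_iff (ε : C →ₗ[ℂ] ℂ) :
    IsInnerCoaction ε ρ ↔ ∃ w, IsImplementedBy ρ w ∧ appRight ε w = 1 := by
  simp only [IsInnerCoaction, tstarWith_star]
  exact ⟨fun ⟨w, h1, h2, h3, h4⟩ => ⟨w, ⟨h1, h2, h3⟩, h4⟩,
    fun ⟨w, ⟨h1, h2, h3⟩, h4⟩ => ⟨w, h1, h2, h3, h4⟩⟩

lemma isStronglyInnerCoaction_iff (Δ : C →ₗ[ℂ] C ⊗[ℂ] C) (ε : C →ₗ[ℂ] ℂ) :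
    IsStronglyInnerCoaction Δ ε ρ ↔ ∃ w, IsImplementedBy ρ w ∧ appRight ε w = 1 ∧
      comulLeg Δ A w = (w ⊗ₜ 1) * insertLeg C A w := by
  simp only [IsStronglyInnerCoaction, tstarWith_star, appRight_dualMul_iff]
  exact ⟨fun ⟨w, h1, h2, h3, h4⟩ => ⟨w, ⟨h1, h2, h3⟩, h4⟩,
    fun ⟨w, ⟨h1, h2, h3⟩, h4⟩ => ⟨w, h1, h2, h3, h4⟩⟩

lemma IsImplementedBy.exists_implements_right {ε : C →ₗ[ℂ] ℂ} (he : bm.IsEquivalence)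
    (hl : IsWeakCoactionBimod ε bm ρ σ lam) (hw : IsImplementedBy ρ w) :
    ∃ z : B ⊗[ℂ] C, Implements bm lam w z := by
  obtain ⟨z, hz⟩ := he.exists_eq_trs ((mulRight bm.lsₗ (star w)) ∘ₗ lam) fun a x => by
    have h := hl.ls_compat a x
    rw [show tact bm.ls (ρ a) (lam x) = _ from tact_eq_mulRight bm.lsₗ (ρ a) (lam x)] at h
    simp only [LinearMap.comp_apply]
    rw [h, hw.eq, ← bm.tls_mul, ← bm.tls_mul, ← mul_assoc, ← mul_assoc, hw.star_mul, one_mul]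
  refine ⟨z, fun x => ?_⟩
  rw [← bm.tls_trs, ← hz, LinearMap.comp_apply, ← bm.tls_mul, hw.mul_star, bm.tls_one]

lemma IsImplementedBy.exists_implements_left {ε : C →ₗ[ℂ] ℂ} (he : bm.IsEquivalence)
    (hl : IsWeakCoactionBimod ε bm ρ σ lam) {v : B ⊗[ℂ] C} (hv : IsImplementedBy σ v) :
    ∃ w : A ⊗[ℂ] C, Implements bm lam w (star v) := by
  obtain ⟨w, hw⟩ := he.exists_eq_tls ((mulRight bm.rsₗ).flip v ∘ₗ lam) fun x b => by
    have h := hl.rs_compat x b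
    rw [show tact bm.rs (lam x) (σ b) = _ from tact_eq_mulRight bm.rsₗ (lam x) (σ b)] at h
    simp only [LinearMap.comp_apply, LinearMap.flip_apply]
    rw [h, hv.eq, ← bm.trs_mul, ← bm.trs_mul, mul_assoc, hv.star_mul, mul_one]
  refine ⟨w, fun x => ?_⟩
  rw [← hw, LinearMap.comp_apply, LinearMap.flip_apply, ← bm.trs_mul, hv.mul_star, bm.trs_one]

lemma Implements.rinn_eq {ε : C →ₗ[ℂ] ℂ} (hl : IsWeakCoactionBimod ε bm ρ σ lam)
    (h : Implements bm lam w z) (x y : X) :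
    σ (bm.rinn x y)
      = star z * bm.trinn (x ⊗ₜ 1) (mulRight bm.lsₗ (star w * w) (y ⊗ₜ 1)) * z := by
  rw [hl.rinn_compat, bm.tinnR_eq, h x, h y, bm.trinn_rs, bm.trinn_rs_left, bm.trinn_ls,
    ← bm.tls_mul]

lemma Implements.linn_eq {ε : C →ₗ[ℂ] ℂ} (hl : IsWeakCoactionBimod ε bm ρ σ lam)
    (h : Implements bm lam w z) (x y : X) :
    ρ (bm.linn x y)
      = w * bm.tlinn (mulRight bm.rsₗ (x ⊗ₜ 1) (z * star z)) (y ⊗ₜ 1) * star w := by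
  rw [hl.linn_compat, bm.tinnL_eq, h x, h y, ← bm.tls_trs, ← bm.tls_trs, bm.tlinn_ls,
    bm.tlinn_ls_right, ← mul_assoc, bm.trs_mul, bm.tlinn_rs _ _ (star z), star_star]

lemma Implements.isImplementedBy_right {ε : C →ₗ[ℂ] ℂ} (he : bm.IsEquivalence)
    (hl : IsWeakCoactionBimod ε bm ρ σ lam) (hσ : σ 1 = 1) (hw : IsImplementedBy ρ w)
    (h : Implements bm lam w z) : IsImplementedBy σ (star z) := by
  have hs : ∀ b, σ b = star z * (b ⊗ₜ 1) * z := by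
    refine he.rinn_induction (fun x y => ?_) (by simp) (fun b b' hb hb' => ?_) (fun c b hb => ?_)
    · rw [h.rinn_eq hl, hw.star_mul, bm.tls_one]
      simp
    · rw [map_add, hb, hb', TensorProduct.add_tmul, mul_add, add_mul]
    · rw [map_smul, hb, ← TensorProduct.smul_tmul', mul_smul_comm, smul_mul_assoc]
  have h1 : star z * z = 1 := by
    rw [← hσ, hs 1, ← Algebra.TensorProduct.one_def, mul_one]
  have h2 : z * star z = 1 := by
    refine mulRight_faithful_right (ι := id) he.rs_faithful _ _ fun x => ?_
    have key : ∀ b : B, mulRight bm.rsₗ (mulRight bm.rsₗ (x ⊗ₜ 1) (z * star z)) (b ⊗ₜ 1)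
        = mulRight bm.rsₗ (x ⊗ₜ 1) (b ⊗ₜ (1 : C)) := by
      refine he.rinn_induction (fun y y' => ?_) (by simp) (fun b b' hb hb' => ?_)
        (fun c b hb => ?_)
      · have e : bm.trinn (y ⊗ₜ[ℂ] (1 : C)) (y' ⊗ₜ[ℂ] (1 : C)) = bm.rinn y y' ⊗ₜ 1 := by simp
        rw [← e, ← he.tls_tlinn, ← he.tls_tlinn]
        congr 2
        have := h.linn_eq hl x y
        rw [hw.eq] at this
        have := congrArg (fun t => star w * t * w) this
        simp only [mul_assoc, hw.star_mul, mul_one] at this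
        simp only [← mul_assoc, hw.star_mul, one_mul] at this
        rw [← this]
        simp
      · rw [TensorProduct.add_tmul, map_add, map_add, hb, hb']
      · rw [← TensorProduct.smul_tmul', map_smul, map_smul, hb]
    have := key 1
    rwa [← Algebra.TensorProduct.one_def, bm.trs_one] at this
  exact ⟨by rwa [star_star], by rwa [star_star], fun b => by rw [star_star, hs]⟩

lemma Implements.isImplementedBy_left {ε : C →ₗ[ℂ] ℂ} (he : bm.IsEquivalence)
    (hl : IsWeakCoactionBimod ε bm ρ σ lam) (hρ : ρ 1 = 1) (hz : IsImplementedBy σ (star z))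
    (h : Implements bm lam w z) : IsImplementedBy ρ w := by
  obtain ⟨z1, z2, z3⟩ := hz
  simp only [star_star] at z1 z2 z3
  have hs : ∀ a, ρ a = w * (a ⊗ₜ 1) * star w := by
    refine he.linn_induction (fun x y => ?_) (by simp) (fun b b' hb hb' => ?_) (fun c b hb => ?_)
    · rw [h.linn_eq hl, z2, bm.trs_one]
      simp
    · rw [map_add, hb, hb', TensorProduct.add_tmul, mul_add, add_mul]
    · rw [map_smul, hb, ← TensorProduct.smul_tmul', mul_smul_comm, smul_mul_assoc]
  have h1 : w * star w = 1 := by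
    rw [← hρ, hs 1, ← Algebra.TensorProduct.one_def, mul_one]
  have h2 : star w * w = 1 := by
    refine mulRight_faithful_left (ι := id) he.ls_faithful _ _ fun x => ?_
    have key : ∀ a : A, mulRight bm.lsₗ (a ⊗ₜ 1) (mulRight bm.lsₗ (star w * w) (x ⊗ₜ 1))
        = mulRight bm.lsₗ (a ⊗ₜ (1 : C)) (x ⊗ₜ 1) := by
      refine he.linn_induction (fun y' y => ?_) (by simp) (fun b b' hb hb' => ?_)
        (fun c b hb => ?_)
      · have e : bm.tlinn (y' ⊗ₜ[ℂ] (1 : C)) (y ⊗ₜ[ℂ] (1 : C)) = bm.linn y' y ⊗ₜ 1 := by simp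
        rw [← e, he.tls_tlinn, he.tls_tlinn]
        congr 1
        have := h.rinn_eq hl y x
        rw [z3] at this
        have := congrArg (fun t => z * t * star z) this
        simp only [mul_assoc, z2, mul_one] at this
        simp only [← mul_assoc, z2, one_mul] at this
        rw [← this]
        simp
      · rw [TensorProduct.add_tmul, map_add, LinearMap.add_apply, LinearMap.add_apply, hb, hb']
      · rw [← TensorProduct.smul_tmul', map_smul, LinearMap.smul_apply, LinearMap.smul_apply, hb]
    have := key 1
    rwa [← Algebra.TensorProduct.one_def, bm.tls_one, bm.tls_one, ← bm.tls_one (x ⊗ₜ[ℂ] (1 : C)),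
      ← bm.tls_mul, mul_one] at this
  exact ⟨h1, h2, hs⟩

lemma Implements.appRight_eq {ε : C →ₐ[ℂ] ℂ}
    (hl : IsWeakCoactionBimod ε.toLinearMap bm ρ σ lam) (h : Implements bm lam w z) (x : X) :
    bm.rs (bm.ls (appRight ε.toLinearMap w) x) (appRight ε.toLinearMap z) = x := by
  conv_rhs => rw [← hl.counital x, h x, appRight_mulRight, appRight_mulRight]
  simp

lemma appRight_mul {D : Type*} [Ring D] [Algebra ℂ D] (ε : C →ₐ[ℂ] ℂ) (s t : D ⊗[ℂ] C) :
    appRight ε.toLinearMap (s * t) = appRight ε.toLinearMap s * appRight ε.toLinearMap t := by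
  simpa [mulRight_mul_eq] using appRight_mulRight ε (LinearMap.mul ℂ D) s t

lemma appRight_one {D : Type*} [Ring D] [Algebra ℂ D] (ε : C →ₐ[ℂ] ℂ) :
    appRight ε.toLinearMap (1 : D ⊗[ℂ] C) = 1 := by
  simp [Algebra.TensorProduct.one_def]

lemma appRight_eq_one_of_mul_eq_one {D : Type*} [Ring D] [Algebra ℂ D] {ε : C →ₐ[ℂ] ℂ}
    {s t : D ⊗[ℂ] C} (h : s * t = 1) (ht : appRight ε.toLinearMap t = 1) :
    appRight ε.toLinearMap s = 1 := by
  rw [← mul_one (appRight _ s)]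
  conv_lhs => rw [← ht]
  rw [← appRight_mul, h, appRight_one]

lemma Implements.appRight_right {ε : C →ₐ[ℂ] ℂ} (he : bm.IsEquivalence)
    (hl : IsWeakCoactionBimod ε.toLinearMap bm ρ σ lam) (h : Implements bm lam w z)
    (hw : appRight ε.toLinearMap w = 1) : appRight ε.toLinearMap z = 1 :=
  he.rs_faithful _ _ fun x => by
    have := h.appRight_eq hl x
    rw [hw, bm.ls_one] at this
    simp [this, bm.rs_one]

lemma Implements.appRight_left {ε : C →ₐ[ℂ] ℂ} (he : bm.IsEquivalence)
    (hl : IsWeakCoactionBimod ε.toLinearMap bm ρ σ lam) (h : Implements bm lam w z)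
    (hz : appRight ε.toLinearMap z = 1) : appRight ε.toLinearMap w = 1 :=
  he.ls_faithful _ _ fun x => by
    have := h.appRight_eq hl x
    rw [hz, bm.rs_one] at this
    simp [this, bm.ls_one]

/-- Coassociativity of `lam`, expressed through the implementing elements. -/
lemma Implements.coassoc {Δ : C →ₐ[ℂ] C ⊗[ℂ] C} {ε : C →ₗ[ℂ] ℂ}
    (hl : IsCoactionBimod Δ.toLinearMap ε bm ρ σ lam) (h : Implements bm lam w z) (x : X) :
    mulRight (mulRight bm.rsₗ)
        (mulRight (mulRight bm.lsₗ) ((w ⊗ₜ 1) * insertLeg C A w) ((x ⊗ₜ 1) ⊗ₜ 1))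
        (insertLeg C B z * (z ⊗ₜ 1))
      = mulRight (mulRight bm.rsₗ)
          (mulRight (mulRight bm.lsₗ) (comulLeg Δ.toLinearMap A w) ((x ⊗ₜ 1) ⊗ₜ (1 : C)))
          (comulLeg Δ.toLinearMap B z) := by
  have hmap : ∀ t : X ⊗[ℂ] C, TensorProduct.map lam LinearMap.id t
      = mulRight (mulRight bm.rsₗ) (mulRight (mulRight bm.lsₗ) (w ⊗ₜ 1) (insertLeg C X t))
          (z ⊗ₜ 1) := by
    intro t
    induction t using TensorProduct.induction_on with
    | zero => simp
    | add s t hs ht => simp only [map_add, LinearMap.add_apply, hs, ht]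
    | tmul y c => simp [h y]
  have e := hl.coassoc x
  change _ = comulLeg Δ.toLinearMap X (lam x) at e
  rw [hmap, h x, insertLeg_mulRight, insertLeg_mulRight, comulLeg_mulRight, comulLeg_mulRight,
    comulLeg_tmul_one, insertLeg_tmul] at e
  rw [← e, mulRight_mul_right bm.trs_mul, mulRight_mul_left bm.tls_mul,
    mulRight_assoc (g := mulRight bm.lsₗ) (f := mulRight bm.rsₗ)
      (k := mulRight bm.rsₗ) (h := mulRight bm.lsₗ) (fun a t b => bm.tls_trs a t b)]

lemma Implements.comulLeg_right {Δ : C →ₐ[ℂ] C ⊗[ℂ] C} {ε : C →ₗ[ℂ] ℂ} (he : bm.IsEquivalence)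
    (hl : IsCoactionBimod Δ.toLinearMap ε bm ρ σ lam) (h : Implements bm lam w z)
    (hw : star w * w = 1)
    (hΔ : comulLeg Δ.toLinearMap A w = (w ⊗ₜ 1) * insertLeg C A w) :
    comulLeg Δ.toLinearMap B z = insertLeg C B z * (z ⊗ₜ 1) := by
  refine (mulRight_faithful_right (ι := fun x : X => x ⊗ₜ[ℂ] (1 : C))
    (mulRight_faithful_right (ι := id) he.rs_faithful) _ _ fun x => ?_).symm
  have e := h.coassoc hl x
  rw [← hΔ, ← mulRight_assoc bm.tls_trs, ← mulRight_assoc bm.tls_trs] at e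
  have e' := congrArg (mulRight (mulRight bm.lsₗ) (comulLeg Δ.toLinearMap A (star w))) e
  rwa [← mulRight_mul_left bm.tls_mul, ← mulRight_mul_left bm.tls_mul, ← comulLeg_mul, hw,
    comulLeg_one, mulRight_one_left bm.tls_one, mulRight_one_left bm.tls_one] at e'

lemma Implements.comulLeg_left {Δ : C →ₐ[ℂ] C ⊗[ℂ] C} {ε : C →ₗ[ℂ] ℂ} (he : bm.IsEquivalence)
    (hl : IsCoactionBimod Δ.toLinearMap ε bm ρ σ lam) (h : Implements bm lam w z)
    (hz : z * star z = 1)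
    (hΔ : comulLeg Δ.toLinearMap B z = insertLeg C B z * (z ⊗ₜ 1)) :
    comulLeg Δ.toLinearMap A w = (w ⊗ₜ 1) * insertLeg C A w := by
  refine (mulRight_faithful_left (ι := fun x : X => x ⊗ₜ[ℂ] (1 : C))
    (mulRight_faithful_left (ι := id) he.ls_faithful) _ _ fun x => ?_).symm
  have e := h.coassoc hl x
  rw [← hΔ] at e
  have e' := congrArg
    (fun t => mulRight (mulRight bm.rsₗ) t (comulLeg Δ.toLinearMap B (star z))) e
  simp only [← mulRight_mul_right bm.trs_mul, ← comulLeg_mul, hz, comulLeg_one,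
    mulRight_one_right bm.trs_one] at e'
  exact e'

end Implementation

/-- (i) Let `ρ` and `σ` be weak coactions of `H0` on unital C*-algebras `A`
and `B` respectively.  If `ρ` is strongly Morita equivalent to `σ`, then `ρ` is inner iff
`σ` is inner.  (ii) Let `ρ` and `σ` be coactions of `H0` on `A` and `B` respectively.  If
`ρ` is strongly Morita equivalent to `σ`, then `ρ` is strongly inner iff `σ` is strongly
inner. -/
theorem inner_of_strongMorita
    {H0 : Type u} [CStarAlgebra H0] [StarModule ℂ H0] [FiniteDimensional ℂ H0]
    {A B : Type u} [CStarAlgebra A] [StarModule ℂ A] [CStarAlgebra B] [StarModule ℂ B]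
    (hd : HopfAlgData H0) :
    (∀ (ρ : A →ₗ[ℂ] A ⊗[ℂ] H0) (σ : B →ₗ[ℂ] B ⊗[ℂ] H0),
      IsWeakCoaction hd.counit.toLinearMap ρ → IsWeakCoaction hd.counit.toLinearMap σ →
      WeakSME hd.counit.toLinearMap ρ σ →
      (IsInnerCoaction hd.counit.toLinearMap ρ ↔ IsInnerCoaction hd.counit.toLinearMap σ)) ∧
    (∀ (ρ : A →ₗ[ℂ] A ⊗[ℂ] H0) (σ : B →ₗ[ℂ] B ⊗[ℂ] H0),
      IsCoaction hd.comul.toLinearMap hd.counit.toLinearMap ρ →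
      IsCoaction hd.comul.toLinearMap hd.counit.toLinearMap σ →
      CoactSME hd.comul.toLinearMap hd.counit.toLinearMap ρ σ →
      (IsStronglyInnerCoaction hd.comul.toLinearMap hd.counit.toLinearMap ρ ↔
        IsStronglyInnerCoaction hd.comul.toLinearMap hd.counit.toLinearMap σ)) := by
  refine ⟨?_, ?_⟩
  · rintro ρ σ hρ hσ ⟨X, _, _, bm, he, lam, hl⟩
    rw [isInnerCoaction_iff, isInnerCoaction_iff]
    constructor
    · rintro ⟨w, hw, hε⟩
      obtain ⟨z, h⟩ := hw.exists_implements_right he hl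
      have hz := h.isImplementedBy_right he hl hσ.map_one hw
      exact ⟨star z, hz, appRight_eq_one_of_mul_eq_one (by simpa using hz.mul_star)
        (h.appRight_right he hl hε)⟩
    · rintro ⟨v, hv, hε⟩
      obtain ⟨w, h⟩ := hv.exists_implements_left he hl
      exact ⟨w, h.isImplementedBy_left he hl hρ.map_one ((star_star v).symm ▸ hv),
        h.appRight_left he hl (appRight_eq_one_of_mul_eq_one hv.star_mul hε)⟩
  · rintro ρ σ hρ hσ ⟨X, _, _, bm, he, lam, hl⟩
    have hl' := hl.toIsWeakCoactionBimod
    rw [isStronglyInnerCoaction_iff, isStronglyInnerCoaction_iff]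
    constructor
    · rintro ⟨w, hw, hε, hΔ⟩
      obtain ⟨z, h⟩ := hw.exists_implements_right he hl'
      have hz := h.isImplementedBy_right he hl' hσ.map_one hw
      have h1 : star z * z = 1 := by simpa using hz.mul_star
      have h2 : z * star z = 1 := by simpa using hz.star_mul
      exact ⟨star z, hz, appRight_eq_one_of_mul_eq_one h1 (h.appRight_right he hl' hε),
        (comulLeg_inv_iff hd.comul h1 h2).2 (h.comulLeg_right he hl hw.star_mul hΔ)⟩
    · rintro ⟨v, hv, hε, hΔ⟩
      obtain ⟨w, h⟩ := hv.exists_implements_left he hl'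
      exact ⟨w, h.isImplementedBy_left he hl' hρ.map_one ((star_star v).symm ▸ hv),
        h.appRight_left he hl' (appRight_eq_one_of_mul_eq_one hv.star_mul hε),
        h.comulLeg_left he hl ((star_star v).symm ▸ hv.star_mul)
          ((comulLeg_inv_iff hd.comul hv.mul_star hv.star_mul).1 hΔ)⟩

end SMEPaper
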